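/- Let H and A be as in the bigraded Scenario II setting (H a bigraded Hopf algebra with conditions (i)–(iv), A a compatible bigraded right H-comodule algebra, B = A^{coH}), and let H_Θ, A_Θ, B_Θ be the deformations by Θ. Define χ_Θ : A_Θ⊗_{B_Θ}A_Θ → A_Θ⊗H_Θ as the map induced by a′⊗a ↦ (a′ ·_Θ a₍₀₎) ⊗ a₍₁₎. Then χ_Θ is bijective if and only if the undeformed canonical map χ : A⊗_B A → A⊗H is bijective; moreover, when bijective, the translation map of χ_Θ is the same linear map as the translation map of χ. -/

import Mathlib

/- Statement 13 (Scenario II): In the bigraded setting, the deformed canonical map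
χ_Θ : A_Θ ⊗_{B_Θ} A_Θ → A_Θ ⊗ H_Θ, a' ⊗ a ↦ (a' ·_Θ a₍₀₎) ⊗ a₍₁₎ is bijective iff the
undeformed canonical map χ is; moreover, when bijective, the two translation maps are
the same linear map (they admit common representatives). -/

open TensorProduct DirectSum

noncomputable section

/-- The phase factor `λ_θ(r,l) = exp(πi⟨θr,l⟩)`. -/
def phase {n : ℕ} (θ : Matrix (Fin n) (Fin n) ℝ) (r l : Fin n → ℤ) : ℂ :=
  Complex.exp ((Real.pi : ℂ) * Complex.I * ∑ j, ∑ k, (θ j k : ℂ) * (r k : ℂ) * (l j : ℂ))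

/-- The phase factor for the matrix `Θ = diag(θ, -θ)` on the bigrading:
`λ_Θ((r₁,r₂),(l₁,l₂)) = λ_θ(r₁,l₁)·λ_{-θ}(r₂,l₂)`. -/
def phaseTheta {n : ℕ} (θ : Matrix (Fin n) (Fin n) ℝ)
    (r l : (Fin n → ℤ) × (Fin n → ℤ)) : ℂ :=
  phase θ r.1 l.1 * phase (-θ) r.2 l.2

/-- The deformation of the product of a graded algebra by a "bi-character" `c`:
the bilinear extension of `a_r ⊗ ã_l ↦ c r l • (a_r * ã_l)` on homogeneous elements. -/
def defMul {ι : Type} [DecidableEq ι] {A : Type} [Ring A] [Algebra ℂ A]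
    (𝒜 : ι → Submodule ℂ A) [DirectSum.Decomposition 𝒜] (c : ι → ι → ℂ) :
    A →ₗ[ℂ] A →ₗ[ℂ] A :=
  let bil : (⨁ r, ↥(𝒜 r)) →ₗ[ℂ] (⨁ l, ↥(𝒜 l)) →ₗ[ℂ] A :=
    DirectSum.toModule ℂ ι _ (fun r =>
      (DirectSum.toModule ℂ ι (↥(𝒜 r) →ₗ[ℂ] A) (fun l =>
        (c r l • ((LinearMap.mul ℂ A).compl₁₂ (𝒜 r).subtype (𝒜 l).subtype)).flip)).flip)
  let dec : A →ₗ[ℂ] ⨁ r, ↥(𝒜 r) := (DirectSum.decomposeLinearEquiv 𝒜).toLinearMap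
  (bil ∘ₗ dec).compl₂ dec

variable {H A : Type} [Ring H] [HopfAlgebra ℂ H] [Ring A] [Algebra ℂ A]

/-- The coinvariant subspace `B = A^{co H}`. -/
def coinv (δ : A →ₐ[ℂ] A ⊗[ℂ] H) : Set A := {a | δ a = a ⊗ₜ[ℂ] (1 : H)}

/-- The relation submodule defining `A ⊗_B A` for a bilinear product `m` on `A`. -/
def galRelOf (δ : A →ₐ[ℂ] A ⊗[ℂ] H) (m : A →ₗ[ℂ] A →ₗ[ℂ] A) : Submodule ℂ (A ⊗[ℂ] A) :=
  Submodule.span ℂ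
    {x | ∃ (a a' b : A), b ∈ coinv δ ∧ x = (m a b) ⊗ₜ[ℂ] a' - a ⊗ₜ[ℂ] (m b a')}

/-- The (unbalanced) canonical Galois map for a bilinear product `m` on `A`:
`a' ⊗ a ↦ m(a', a₍₀₎) ⊗ a₍₁₎`. -/
def chiOf (δ : A →ₐ[ℂ] A ⊗[ℂ] H) (m : A →ₗ[ℂ] A →ₗ[ℂ] A) :
    A ⊗[ℂ] A →ₗ[ℂ] A ⊗[ℂ] H :=
  (TensorProduct.map (TensorProduct.lift m) LinearMap.id) ∘ₗ
    ((TensorProduct.assoc ℂ A A H).symm.toLinearMap) ∘ₗ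
      (TensorProduct.map LinearMap.id δ.toLinearMap)

section Twist

variable {ι κ M N : Type} [DecidableEq ι] [DecidableEq κ]
  [AddCommGroup M] [Module ℂ M] [AddCommGroup N] [Module ℂ N]

lemma decomposeLinearEquiv_of_mem (ℳ : ι → Submodule ℂ M) [DirectSum.Decomposition ℳ]
    {i : ι} {x : M} (hx : x ∈ ℳ i) :
    DirectSum.decomposeLinearEquiv ℳ x = DirectSum.lof ℂ ι (fun i => ℳ i) i ⟨x, hx⟩ :=
  DirectSum.decompose_of_mem ℳ hx

/-- The linear endomorphism scaling the component of degree `i` by `f i`. -/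
def gradedScale (ℳ : ι → Submodule ℂ M) [DirectSum.Decomposition ℳ] (f : ι → ℂ) : M →ₗ[ℂ] M :=
  DirectSum.toModule ℂ ι M (fun i => f i • (ℳ i).subtype) ∘ₗ
    (DirectSum.decomposeLinearEquiv ℳ).toLinearMap

lemma gradedScale_of_mem (ℳ : ι → Submodule ℂ M) [DirectSum.Decomposition ℳ] (f : ι → ℂ)
    {i : ι} {x : M} (hx : x ∈ ℳ i) : gradedScale ℳ f x = f i • x := by
  simp [gradedScale, decomposeLinearEquiv_of_mem ℳ hx]

lemma gradedScale_single (ℳ : ι → Submodule ℂ M) [DirectSum.Decomposition ℳ] (i : ι) (x : M) :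
    gradedScale ℳ (Pi.single i 1) x = DirectSum.decompose ℳ x i := by
  induction x using DirectSum.Decomposition.inductionOn ℳ with
  | zero => simp
  | @homogeneous j m =>
    rw [gradedScale_of_mem ℳ _ m.2]
    by_cases h : j = i
    · subst h; simp
    · rw [DirectSum.decompose_of_mem_ne ℳ m.2 h]
      simp [h]
  | add a b ha hb => simp [ha, hb]

/-- The endomorphism of `M ⊗ N` scaling the component of bidegree `(i, j)` by `c i j`. -/
def gradedTwist (ℳ : ι → Submodule ℂ M) [DirectSum.Decomposition ℳ]
    (𝒩 : κ → Submodule ℂ N) [DirectSum.Decomposition 𝒩] (c : ι → κ → ℂ) :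
    M ⊗[ℂ] N →ₗ[ℂ] M ⊗[ℂ] N :=
  TensorProduct.lift
    (DirectSum.toModule ℂ ι (N →ₗ[ℂ] M ⊗[ℂ] N) (fun i =>
      ((TensorProduct.mk ℂ M N).compl₂ (gradedScale 𝒩 (c i))) ∘ₗ (ℳ i).subtype) ∘ₗ
    (DirectSum.decomposeLinearEquiv ℳ).toLinearMap)

lemma gradedTwist_of_mem (ℳ : ι → Submodule ℂ M) [DirectSum.Decomposition ℳ]
    (𝒩 : κ → Submodule ℂ N) [DirectSum.Decomposition 𝒩] (c : ι → κ → ℂ)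
    {i : ι} {j : κ} {x : M} {y : N} (hx : x ∈ ℳ i) (hy : y ∈ 𝒩 j) :
    gradedTwist ℳ 𝒩 c (x ⊗ₜ y) = c i j • (x ⊗ₜ[ℂ] y) := by
  simp [gradedTwist, decomposeLinearEquiv_of_mem ℳ hx, gradedScale_of_mem 𝒩 _ hy]

/-- Linear maps on a tensor product of graded modules agree once they agree on homogeneous
tensors. -/
lemma linearMap_ext_of_homogeneous {P : Type} [AddCommGroup P] [Module ℂ P]
    (ℳ : ι → Submodule ℂ M) [DirectSum.Decomposition ℳ]
    (𝒩 : κ → Submodule ℂ N) [DirectSum.Decomposition 𝒩] {f g : M ⊗[ℂ] N →ₗ[ℂ] P}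
    (h : ∀ i j, ∀ x ∈ ℳ i, ∀ y ∈ 𝒩 j, f (x ⊗ₜ y) = g (x ⊗ₜ y)) : f = g := by
  ext x y
  change f (x ⊗ₜ y) = g (x ⊗ₜ y)
  induction x using DirectSum.Decomposition.inductionOn ℳ with
  | zero => simp
  | add a b ha hb => simp [TensorProduct.add_tmul, ha, hb]
  | @homogeneous i m =>
    induction y using DirectSum.Decomposition.inductionOn 𝒩 with
    | zero => simp
    | add a b ha hb => simp [TensorProduct.tmul_add, ha, hb]
    | @homogeneous j m' => exact h i j _ m.2 _ m'.2

lemma gradedTwist_one (ℳ : ι → Submodule ℂ M) [DirectSum.Decomposition ℳ]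
    (𝒩 : κ → Submodule ℂ N) [DirectSum.Decomposition 𝒩] :
    gradedTwist ℳ 𝒩 1 = LinearMap.id :=
  linearMap_ext_of_homogeneous ℳ 𝒩 fun i j x hx y hy => by
    simp [gradedTwist_of_mem ℳ 𝒩 _ hx hy]

lemma gradedTwist_comp (ℳ : ι → Submodule ℂ M) [DirectSum.Decomposition ℳ]
    (𝒩 : κ → Submodule ℂ N) [DirectSum.Decomposition 𝒩] (c d : ι → κ → ℂ) :
    gradedTwist ℳ 𝒩 c ∘ₗ gradedTwist ℳ 𝒩 d = gradedTwist ℳ 𝒩 (c * d) :=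
  linearMap_ext_of_homogeneous ℳ 𝒩 fun i j x hx y hy => by
    simp [gradedTwist_of_mem ℳ 𝒩 _ hx hy, smul_smul, mul_comm]

/-- The twist by a nowhere vanishing function, as a linear equivalence. -/
def gradedTwistEquiv (ℳ : ι → Submodule ℂ M) [DirectSum.Decomposition ℳ]
    (𝒩 : κ → Submodule ℂ N) [DirectSum.Decomposition 𝒩] (c : ι → κ → ℂ)
    (hc : ∀ i j, c i j ≠ 0) : M ⊗[ℂ] N ≃ₗ[ℂ] M ⊗[ℂ] N :=
  LinearEquiv.ofLinearMap (gradedTwist ℳ 𝒩 c) (gradedTwist ℳ 𝒩 c⁻¹)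
    (by rw [gradedTwist_comp, ← gradedTwist_one ℳ 𝒩]; congr 1; ext i j; simp [hc])
    (by rw [gradedTwist_comp, ← gradedTwist_one ℳ 𝒩]; congr 1; ext i j; simp [hc])

lemma gradedTwistEquiv_apply (ℳ : ι → Submodule ℂ M) [DirectSum.Decomposition ℳ]
    (𝒩 : κ → Submodule ℂ N) [DirectSum.Decomposition 𝒩] (c : ι → κ → ℂ)
    (hc : ∀ i j, c i j ≠ 0) (x : M ⊗[ℂ] N) :
    gradedTwistEquiv ℳ 𝒩 c hc x = gradedTwist ℳ 𝒩 c x := rfl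

lemma gradedTwist_inv_apply_apply (ℳ : ι → Submodule ℂ M) [DirectSum.Decomposition ℳ]
    (𝒩 : κ → Submodule ℂ N) [DirectSum.Decomposition 𝒩] {c : ι → κ → ℂ}
    (hc : ∀ i j, c i j ≠ 0) (x : M ⊗[ℂ] N) :
    gradedTwist ℳ 𝒩 c⁻¹ (gradedTwist ℳ 𝒩 c x) = x := by
  have h : c⁻¹ * c = 1 := by ext i j; simp [hc]
  rw [← LinearMap.comp_apply, gradedTwist_comp, h, gradedTwist_one, LinearMap.id_apply]

end Twist

section Phase

variable {n : ℕ} (θ : Matrix (Fin n) (Fin n) ℝ)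

lemma phase_ne_zero (r l : Fin n → ℤ) : phase θ r l ≠ 0 := Complex.exp_ne_zero _

lemma phase_add_left (r r' l : Fin n → ℤ) :
    phase θ (r + r') l = phase θ r l * phase θ r' l := by
  simp only [phase, ← Complex.exp_add, ← mul_add, ← Finset.sum_add_distrib]
  congr 2
  refine Finset.sum_congr rfl fun j _ => Finset.sum_congr rfl fun k _ => ?_
  simp only [Pi.add_apply]; push_cast; ring

lemma phase_add_right (r l l' : Fin n → ℤ) :
    phase θ r (l + l') = phase θ r l * phase θ r l' := by
  simp only [phase, ← Complex.exp_add, ← mul_add, ← Finset.sum_add_distrib]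
  congr 2
  refine Finset.sum_congr rfl fun j _ => Finset.sum_congr rfl fun k _ => ?_
  simp only [Pi.add_apply]; push_cast; ring

lemma phase_zero_left (l : Fin n → ℤ) : phase θ 0 l = 1 := by simp [phase]

lemma phase_zero_right (r : Fin n → ℤ) : phase θ r 0 = 1 := by simp [phase]

variable {θ}

lemma phase_self (hθ : ∀ j k, θ k j = - θ j k) (r : Fin n → ℤ) : phase θ r r = 1 := by
  have h : ∑ j, ∑ k, (θ j k : ℂ) * (r k : ℂ) * (r j : ℂ) = 0 := by
    rw [← CharZero.eq_neg_self_iff]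
    conv_lhs => rw [Finset.sum_comm]
    simp only [← Finset.sum_neg_distrib]
    refine Finset.sum_congr rfl fun j _ => Finset.sum_congr rfl fun k _ => ?_
    rw [hθ j k]; push_cast; ring
  simp [phase, h]

end Phase

lemma defMul_of_mem {ι : Type} [DecidableEq ι] {A : Type} [Ring A] [Algebra ℂ A]
    (𝒜 : ι → Submodule ℂ A) [DirectSum.Decomposition 𝒜] (c : ι → ι → ℂ)
    {i j : ι} {x y : A} (hx : x ∈ 𝒜 i) (hy : y ∈ 𝒜 j) :
    defMul 𝒜 c x y = c i j • (x * y) := by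
  simp [defMul, decomposeLinearEquiv_of_mem 𝒜 hx, decomposeLinearEquiv_of_mem 𝒜 hy]

lemma chiOf_tmul (δ : A →ₐ[ℂ] A ⊗[ℂ] H) (m : A →ₗ[ℂ] A →ₗ[ℂ] A) (a a' : A) :
    chiOf δ m (a ⊗ₜ a') = TensorProduct.map (m a) LinearMap.id (δ a') := by
  simp only [chiOf, LinearMap.comp_apply, TensorProduct.map_tmul, LinearMap.id_apply,
    AlgHom.toLinearMap_apply]
  induction δ a' with
  | zero => simp
  | tmul x y => simp
  | add x y hx hy => rw [TensorProduct.tmul_add, map_add, map_add, hx, hy, map_add]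

lemma Submodule.bijective_liftQ_iff {R M N : Type*} [Ring R] [AddCommGroup M] [AddCommGroup N]
    [Module R M] [Module R N] (p : Submodule R M) (f : M →ₗ[R] N) (h : p ≤ LinearMap.ker f) :
    Function.Bijective (p.liftQ f h) ↔ (∀ x, f x = 0 → x ∈ p) ∧ Function.Surjective f := by
  refine and_congr ?_ ?_
  · rw [injective_iff_map_eq_zero, (Submodule.mkQ_surjective p).forall]
    simp
  · rw [← LinearMap.range_eq_top, ← LinearMap.range_eq_top, Submodule.range_liftQ]

/-- Linear maps on `A ⊗ H` which agree on the homogeneous tensors allowed in the coaction of `a`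
agree on the coaction of `a`. -/
lemma eq_on_coaction {G P : Type} [AddCommGroup P] [Module ℂ P]
    {ℋ : G × G → Submodule ℂ H} {𝒜 : G × G → Submodule ℂ A} {r l : G} {z : A ⊗[ℂ] H}
    (hz : z ∈ ⨆ s : G, LinearMap.range
      (TensorProduct.map (𝒜 (r, s)).subtype (ℋ (s, l)).subtype))
    {f g : A ⊗[ℂ] H →ₗ[ℂ] P}
    (h : ∀ s, ∀ x ∈ 𝒜 (r, s), ∀ y ∈ ℋ (s, l), f (x ⊗ₜ y) = g (x ⊗ₜ y)) : f z = g z := by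
  induction hz using Submodule.iSup_induction' with
  | zero => simp
  | add x y _ _ hx hy => simp [hx, hy]
  | mem s x hx =>
    obtain ⟨t, rfl⟩ := hx
    induction t with
    | zero => simp
    | tmul u v => exact h s _ u.2 _ v.2
    | add x y hx hy => simp only [map_add, hx, hy]

section Bigraded

variable {G : Type} [AddCommGroup G] [DecidableEq G]
  {ℋ : G × G → Submodule ℂ H} [GradedAlgebra ℋ] {𝒜 : G × G → Submodule ℂ A} [GradedAlgebra 𝒜]
  {δ : A →ₐ[ℂ] A ⊗[ℂ] H}

/-- Deforming the product in the canonical map amounts to twisting its source and target, when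
the deforming function splits accordingly. -/
lemma gradedTwist_comp_chiOf_comp_gradedTwist
    (hδgrad : ∀ (r l : G), ∀ a ∈ 𝒜 (r, l), δ a ∈ ⨆ s : G, LinearMap.range
      (TensorProduct.map (𝒜 (r, s)).subtype (ℋ (s, l)).subtype))
    {c d e : G × G → G × G → ℂ}
    (h : ∀ p q r s l, d (p, q) (r, l) * e (p + r, q + s) (s, l) = c (p, q) (r, s)) :
    gradedTwist 𝒜 ℋ e ∘ₗ chiOf δ (LinearMap.mul ℂ A) ∘ₗ gradedTwist 𝒜 𝒜 d =
      chiOf δ (defMul 𝒜 c) := by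
  refine linearMap_ext_of_homogeneous 𝒜 𝒜 ?_
  rintro ⟨p, q⟩ ⟨r, l⟩ a ha a' ha'
  simp only [LinearMap.comp_apply, gradedTwist_of_mem 𝒜 𝒜 d ha ha', map_smul, chiOf_tmul]
  refine eq_on_coaction (f := d (p, q) (r, l) • (gradedTwist 𝒜 ℋ e ∘ₗ
    TensorProduct.map (LinearMap.mul ℂ A a) LinearMap.id)) (hδgrad r l a' ha') ?_
  intro s x hx y hy
  have hax : a * x ∈ 𝒜 (p + r, q + s) := SetLike.mul_mem_graded ha hx
  simp [gradedTwist_of_mem 𝒜 ℋ e hax hy, defMul_of_mem 𝒜 c ha hx, smul_smul, h,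
    TensorProduct.smul_tmul']

/-- The homogeneous components of a coinvariant element are coinvariant, and they vanish unless
their right degree is zero. -/
lemma decompose_coinv
    (hcounit : ∀ a : A, (TensorProduct.rid ℂ A)
        ((TensorProduct.map LinearMap.id (Coalgebra.counit (R := ℂ) (A := H))) (δ a)) = a)
    (hδgrad : ∀ (r l : G), ∀ a ∈ 𝒜 (r, l), δ a ∈ ⨆ s : G, LinearMap.range
      (TensorProduct.map (𝒜 (r, s)).subtype (ℋ (s, l)).subtype))
    {b : A} (hb : b ∈ coinv δ) (r l : G) :
    (DirectSum.decompose 𝒜 b (r, l) : A) ∈ coinv δ ∧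
      (l ≠ 0 → (DirectSum.decompose 𝒜 b (r, l) : A) = 0) := by
  let P : A →ₗ[ℂ] A := gradedScale 𝒜 fun i => if i.1 = r then 1 else 0
  let Q : H →ₗ[ℂ] H := gradedScale ℋ fun i => if i.2 = l then 1 else 0
  have key (a : A) :
      δ (gradedScale 𝒜 (Pi.single (r, l) 1) a) = TensorProduct.map P Q (δ a) := by
    induction a using DirectSum.Decomposition.inductionOn 𝒜 with
    | zero => simp
    | add a b ha hb => simp only [map_add, ha, hb]
    | @homogeneous j m =>
      obtain ⟨p, q⟩ := j
      rw [gradedScale_of_mem 𝒜 _ m.2, map_smul]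
      refine eq_on_coaction (f := (Pi.single (r, l) 1 : G × G → ℂ) (p, q) • LinearMap.id)
        (hδgrad p q m m.2) ?_
      intro s x hx y hy
      simp only [P, Q, TensorProduct.map_tmul, gradedScale_of_mem 𝒜 _ hx,
        gradedScale_of_mem ℋ _ hy, TensorProduct.smul_tmul_smul, LinearMap.smul_apply,
        LinearMap.id_apply]
      congr 1
      simp only [Pi.single_apply, Prod.mk.injEq]
      split_ifs <;> simp_all
  have hQ : Q 1 = if (0 : G) = l then 1 else 0 := by
    have : (1 : H) ∈ ℋ ((0 : G), (0 : G)) := SetLike.one_mem_graded ℋ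
    simp only [Q, gradedScale_of_mem ℋ _ this]
    split_ifs <;> simp
  have hbδ : δ b = b ⊗ₜ 1 := hb
  have hδ : δ (DirectSum.decompose 𝒜 b (r, l) : A) = P b ⊗ₜ Q 1 := by
    rw [← gradedScale_single, key, hbδ, TensorProduct.map_tmul]
  have hc := hcounit (DirectSum.decompose 𝒜 b (r, l) : A)
  rw [hδ, hQ] at hc
  rw [hQ] at hδ
  by_cases hl : 0 = l
  · simp only [hl, if_true, TensorProduct.map_tmul, LinearMap.id_apply,
      Bialgebra.counit_one, TensorProduct.rid_tmul, one_smul] at hc hδ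
    exact ⟨by change δ _ = _; rw [hδ, hc], fun h => (h hl.symm).elim⟩
  · simp only [hl, if_false, TensorProduct.tmul_zero, map_zero] at hc
    rw [← hc]
    exact ⟨by simp [coinv], fun _ => rfl⟩

/-- A linear map which rescales the relations between homogeneous elements maps the relation
submodules into each other. -/
lemma galRelOf_le_comap
    (hcounit : ∀ a : A, (TensorProduct.rid ℂ A)
        ((TensorProduct.map LinearMap.id (Coalgebra.counit (R := ℂ) (A := H))) (δ a)) = a)
    (hδgrad : ∀ (r l : G), ∀ a ∈ 𝒜 (r, l), δ a ∈ ⨆ s : G, LinearMap.range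
      (TensorProduct.map (𝒜 (r, s)).subtype (ℋ (s, l)).subtype))
    {m m' : A →ₗ[ℂ] A →ₗ[ℂ] A} {T : A ⊗[ℂ] A →ₗ[ℂ] A ⊗[ℂ] A}
    (h : ∀ i r j, ∀ a ∈ 𝒜 i, ∀ b ∈ 𝒜 (r, 0), ∀ a' ∈ 𝒜 j, ∃ k : ℂ,
      T (m a b ⊗ₜ a' - a ⊗ₜ m b a') = k • (m' a b ⊗ₜ[ℂ] a' - a ⊗ₜ[ℂ] m' b a')) :
    galRelOf δ m ≤ (galRelOf δ m').comap T := by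
  rw [galRelOf, Submodule.span_le]
  rintro _ ⟨a, a', b, hb, rfl⟩
  simp only [SetLike.mem_coe, Submodule.mem_comap]
  induction a using DirectSum.Decomposition.inductionOn 𝒜 with
  | zero => simp
  | add x y hx hy =>
    convert add_mem hx hy using 1
    simp only [map_sub, map_add, LinearMap.add_apply, TensorProduct.add_tmul]
    abel
  | @homogeneous i u =>
  induction a' using DirectSum.Decomposition.inductionOn 𝒜 with
  | zero => simp
  | add x y hx hy =>
    convert add_mem hx hy using 1
    simp only [map_sub, map_add, TensorProduct.tmul_add]
    abel
  | @homogeneous j v =>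
  let F : A →ₗ[ℂ] A ⊗[ℂ] A :=
    T ∘ₗ (((TensorProduct.mk ℂ A A).flip (v : A)) ∘ₗ m u -
      (TensorProduct.mk ℂ A A (u : A)) ∘ₗ m.flip (v : A))
  change F b ∈ _
  classical
  rw [← DirectSum.sum_support_decompose 𝒜 b, map_sum]
  refine sum_mem ?_
  rintro ⟨r, l⟩ -
  obtain ⟨hco, hz⟩ := decompose_coinv hcounit hδgrad hb r l
  by_cases hl : l = 0
  · subst hl
    obtain ⟨k, hk⟩ := h i r j u u.2 _ (DirectSum.decompose 𝒜 b (r, 0)).2 v v.2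
    have : F (DirectSum.decompose 𝒜 b (r, 0) : A) = _ := hk
    rw [this]
    exact Submodule.smul_mem _ _ (Submodule.subset_span ⟨_, _, _, hco, rfl⟩)
  · rw [hz hl, map_zero]
    exact zero_mem _

end Bigraded

section PhaseTheta

variable {n : ℕ} {θ : Matrix (Fin n) (Fin n) ℝ}
  {ℋ : (Fin n → ℤ) × (Fin n → ℤ) → Submodule ℂ H} [GradedAlgebra ℋ]
  {𝒜 : (Fin n → ℤ) × (Fin n → ℤ) → Submodule ℂ A} [GradedAlgebra 𝒜]
  {δ : A →ₐ[ℂ] A ⊗[ℂ] H}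

lemma phase_eq_one_of_add_eq_zero (hθ : ∀ j k, θ k j = - θ j k) {p r : Fin n → ℤ}
    (h : p + r = 0) : phase θ p r = 1 := by
  have := phase_add_left θ p r r
  rwa [h, phase_zero_left, phase_self hθ, mul_one, eq_comm] at this

/-- The phase on `A ⊗ A` coming from the left degrees. -/
def leftPhase (θ : Matrix (Fin n) (Fin n) ℝ) (i j : (Fin n → ℤ) × (Fin n → ℤ)) : ℂ :=
  phase θ i.1 j.1

/-- The phase on `A ⊗ H` coming from the two inner degrees. -/
def innerPhase (θ : Matrix (Fin n) (Fin n) ℝ) (i j : (Fin n → ℤ) × (Fin n → ℤ)) : ℂ :=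
  phase (-θ) i.2 j.1

lemma chiOf_phaseTheta (hθ : ∀ j k, θ k j = - θ j k)
    (hδgrad : ∀ (r l : Fin n → ℤ), ∀ a ∈ 𝒜 (r, l), δ a ∈ ⨆ s : Fin n → ℤ, LinearMap.range
      (TensorProduct.map (𝒜 (r, s)).subtype (ℋ (s, l)).subtype)) (x : A ⊗[ℂ] A) :
    chiOf δ (defMul 𝒜 (phaseTheta θ)) x = gradedTwist 𝒜 ℋ (innerPhase θ)
      (chiOf δ (LinearMap.mul ℂ A) (gradedTwist 𝒜 𝒜 (leftPhase θ) x)) := by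
  have hθ' : ∀ j k, (-θ) k j = - (-θ) j k := fun j k => by simp [hθ j k]
  rw [← gradedTwist_comp_chiOf_comp_gradedTwist (d := leftPhase θ) (e := innerPhase θ) hδgrad]
  · simp only [LinearMap.comp_apply]
  · intro p q r s l
    simp [leftPhase, innerPhase, phaseTheta, phase_add_left, phase_self hθ']

lemma galRelOf_phaseTheta_le_comap
    (hcounit : ∀ a : A, (TensorProduct.rid ℂ A)
        ((TensorProduct.map LinearMap.id (Coalgebra.counit (R := ℂ) (A := H))) (δ a)) = a)
    (hδgrad : ∀ (r l : Fin n → ℤ), ∀ a ∈ 𝒜 (r, l), δ a ∈ ⨆ s : Fin n → ℤ, LinearMap.range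
      (TensorProduct.map (𝒜 (r, s)).subtype (ℋ (s, l)).subtype)) :
    galRelOf δ (defMul 𝒜 (phaseTheta θ)) ≤
      (galRelOf δ (LinearMap.mul ℂ A)).comap (gradedTwist 𝒜 𝒜 (leftPhase θ)) := by
  refine galRelOf_le_comap hcounit hδgrad ?_
  rintro ⟨p, q⟩ r ⟨p', q'⟩ a ha b hb a' ha'
  have hab : a * b ∈ 𝒜 (p + r, q + 0) := SetLike.mul_mem_graded ha hb
  have hba : b * a' ∈ 𝒜 (r + p', 0 + q') := SetLike.mul_mem_graded hb ha'
  refine ⟨phase θ p r * phase θ p p' * phase θ r p', ?_⟩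
  rw [defMul_of_mem 𝒜 _ ha hb, defMul_of_mem 𝒜 _ hb ha', map_sub,
    ← TensorProduct.smul_tmul', TensorProduct.tmul_smul, map_smul, map_smul,
    gradedTwist_of_mem 𝒜 𝒜 _ hab ha', gradedTwist_of_mem 𝒜 𝒜 _ ha hba, smul_smul, smul_smul,
    smul_sub]
  simp only [phaseTheta, leftPhase, phase_add_left, phase_add_right, phase_zero_left,
    phase_zero_right, LinearMap.mul_apply']
  congr 2 <;> ring

lemma galRelOf_mul_le_comap
    (hcounit : ∀ a : A, (TensorProduct.rid ℂ A)
        ((TensorProduct.map LinearMap.id (Coalgebra.counit (R := ℂ) (A := H))) (δ a)) = a)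
    (hδgrad : ∀ (r l : Fin n → ℤ), ∀ a ∈ 𝒜 (r, l), δ a ∈ ⨆ s : Fin n → ℤ, LinearMap.range
      (TensorProduct.map (𝒜 (r, s)).subtype (ℋ (s, l)).subtype)) :
    galRelOf δ (LinearMap.mul ℂ A) ≤
      (galRelOf δ (defMul 𝒜 (phaseTheta θ))).comap (gradedTwist 𝒜 𝒜 (leftPhase θ)⁻¹) := by
  refine galRelOf_le_comap hcounit hδgrad ?_
  rintro ⟨p, q⟩ r ⟨p', q'⟩ a ha b hb a' ha'
  have hab : a * b ∈ 𝒜 (p + r, q + 0) := SetLike.mul_mem_graded ha hb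
  have hba : b * a' ∈ 𝒜 (r + p', 0 + q') := SetLike.mul_mem_graded hb ha'
  refine ⟨(phase θ p r * phase θ p p' * phase θ r p')⁻¹, ?_⟩
  rw [defMul_of_mem 𝒜 _ ha hb, defMul_of_mem 𝒜 _ hb ha', map_sub, LinearMap.mul_apply',
    LinearMap.mul_apply',
    ← TensorProduct.smul_tmul', TensorProduct.tmul_smul,
    gradedTwist_of_mem 𝒜 𝒜 _ hab ha', gradedTwist_of_mem 𝒜 𝒜 _ ha hba,
    smul_sub, smul_smul, smul_smul]
  have h₁ := phase_ne_zero θ p r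
  have h₂ := phase_ne_zero θ p p'
  have h₃ := phase_ne_zero θ r p'
  simp only [phaseTheta, leftPhase, phase_add_left, phase_add_right, phase_zero_left,
    phase_zero_right, Pi.inv_apply]
  congr 2 <;> field_simp

lemma mem_galRelOf_phaseTheta_iff
    (hcounit : ∀ a : A, (TensorProduct.rid ℂ A)
        ((TensorProduct.map LinearMap.id (Coalgebra.counit (R := ℂ) (A := H))) (δ a)) = a)
    (hδgrad : ∀ (r l : Fin n → ℤ), ∀ a ∈ 𝒜 (r, l), δ a ∈ ⨆ s : Fin n → ℤ, LinearMap.range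
      (TensorProduct.map (𝒜 (r, s)).subtype (ℋ (s, l)).subtype)) (x : A ⊗[ℂ] A) :
    x ∈ galRelOf δ (defMul 𝒜 (phaseTheta θ)) ↔
      gradedTwist 𝒜 𝒜 (leftPhase θ) x ∈ galRelOf δ (LinearMap.mul ℂ A) := by
  constructor
  · intro hx
    exact Submodule.mem_comap.mp (galRelOf_phaseTheta_le_comap hcounit hδgrad hx)
  · intro hx
    have := Submodule.mem_comap.mp (galRelOf_mul_le_comap (θ := θ) hcounit hδgrad hx)
    rwa [gradedTwist_inv_apply_apply 𝒜 𝒜 (c := leftPhase θ)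
      fun i j => phase_ne_zero θ i.1 j.1] at this

/-- Elements of the form `1 ⊗ h` have preimages under the canonical map of total left degree
zero, and these are not affected by the deformation. -/
lemma exists_common_translation (hθ : ∀ j k, θ k j = - θ j k)
    (hδgrad : ∀ (r l : Fin n → ℤ), ∀ a ∈ 𝒜 (r, l), δ a ∈ ⨆ s : Fin n → ℤ, LinearMap.range
      (TensorProduct.map (𝒜 (r, s)).subtype (ℋ (s, l)).subtype)) {h : H} {t : A ⊗[ℂ] A}
    (ht : chiOf δ (LinearMap.mul ℂ A) t = 1 ⊗ₜ h) :
    ∃ t : A ⊗[ℂ] A, chiOf δ (LinearMap.mul ℂ A) t = (1 : A) ⊗ₜ[ℂ] h ∧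
      chiOf δ (defMul 𝒜 (phaseTheta θ)) t = (1 : A) ⊗ₜ[ℂ] h := by
  let d : (Fin n → ℤ) × (Fin n → ℤ) → (Fin n → ℤ) × (Fin n → ℤ) → ℂ :=
    fun i j => if i.1 + j.1 = 0 then 1 else 0
  let e : (Fin n → ℤ) × (Fin n → ℤ) → (Fin n → ℤ) × (Fin n → ℤ) → ℂ :=
    fun i _ => if i.1 = 0 then 1 else 0
  have hone : (1 : A) ∈ 𝒜 ((0 : Fin n → ℤ), (0 : Fin n → ℤ)) := SetLike.one_mem_graded 𝒜
  have homog (f : (Fin n → ℤ) × (Fin n → ℤ) → (Fin n → ℤ) × (Fin n → ℤ) → ℂ)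
      (hf : ∀ j, f (0, 0) j = 1) :
      gradedTwist 𝒜 ℋ f (1 ⊗ₜ h) = 1 ⊗ₜ h := by
    have : gradedTwist 𝒜 ℋ f ∘ₗ TensorProduct.mk ℂ A H 1 = TensorProduct.mk ℂ A H 1 := by
      ext y
      induction y using DirectSum.Decomposition.inductionOn ℋ with
      | zero => simp
      | add a b ha hb => rw [map_add, map_add, ha, hb]
      | @homogeneous j m =>
        simp [gradedTwist_of_mem 𝒜 ℋ _ hone m.2, hf]
    exact LinearMap.congr_fun this h
  have hcomm : chiOf δ (LinearMap.mul ℂ A) ∘ₗ gradedTwist 𝒜 𝒜 d =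
      gradedTwist 𝒜 ℋ e ∘ₗ chiOf δ (LinearMap.mul ℂ A) := by
    have h₁ := gradedTwist_comp_chiOf_comp_gradedTwist (c := d) (d := d) (e := 1) hδgrad
      (fun p q r s l => by simp [d])
    have h₂ := gradedTwist_comp_chiOf_comp_gradedTwist (c := d) (d := 1) (e := e) hδgrad
      (fun p q r s l => by simp [d, e])
    rw [gradedTwist_one, LinearMap.id_comp] at h₁
    rw [gradedTwist_one, LinearMap.comp_id] at h₂
    rw [h₁, h₂]
  have hd : leftPhase θ * d = d := by
    ext ⟨p, q⟩ ⟨r, l⟩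
    by_cases hpr : p + r = 0
    · simp [leftPhase, phase_eq_one_of_add_eq_zero hθ hpr]
    · simp [d, hpr]
  have hχt : chiOf δ (LinearMap.mul ℂ A) (gradedTwist 𝒜 𝒜 d t) = 1 ⊗ₜ h := by
    have := LinearMap.congr_fun hcomm t
    rw [LinearMap.comp_apply, LinearMap.comp_apply, ht] at this
    rw [this, homog e (by simp [e])]
  refine ⟨gradedTwist 𝒜 𝒜 d t, hχt, ?_⟩
  rw [chiOf_phaseTheta hθ hδgrad, ← LinearMap.comp_apply (gradedTwist 𝒜 𝒜 (leftPhase θ)),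
    gradedTwist_comp, hd, hχt]
  exact homog _ fun j => phase_zero_left _ _

end PhaseTheta

theorem deformed_canonical_map_bijective_iff_II {n : ℕ} (θ : Matrix (Fin n) (Fin n) ℝ)
    (hθ : ∀ j k, θ k j = - θ j k)
    (ℋ : (Fin n → ℤ) × (Fin n → ℤ) → Submodule ℂ H) [GradedAlgebra ℋ]
    (𝒜 : (Fin n → ℤ) × (Fin n → ℤ) → Submodule ℂ A) [GradedAlgebra 𝒜]
    -- (ii) the coproduct of `H` is compatible with the bigrading
    (hΔ : ∀ (r l : Fin n → ℤ), ∀ h ∈ ℋ (r, l),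
      Coalgebra.comul (R := ℂ) h ∈
        ⨆ s : Fin n → ℤ,
          LinearMap.range (TensorProduct.map (ℋ (r, s)).subtype (ℋ (s, l)).subtype))
    -- (iii) the counit vanishes off the "diagonal" part of the bigrading
    (hε : ∀ (r l : Fin n → ℤ), r ≠ l → ∀ h ∈ ℋ (r, l),
      Coalgebra.counit (R := ℂ) h = (0 : ℂ))
    -- (iv) the antipode maps `H_{(r,l)}` into `H_{(-l,-r)}`
    (hS : ∀ (r l : Fin n → ℤ), ∀ h ∈ ℋ (r, l),
      HopfAlgebra.antipode (R := ℂ) h ∈ ℋ (-l, -r))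
    -- the coaction of `H` on `A`, a comodule algebra structure
    (δ : A →ₐ[ℂ] A ⊗[ℂ] H)
    (hcoassoc : ∀ a : A,
      (TensorProduct.map LinearMap.id (Coalgebra.comul (R := ℂ) (A := H))) (δ a)
        = (TensorProduct.assoc ℂ A H H) ((TensorProduct.map δ.toLinearMap LinearMap.id) (δ a)))
    (hcounit : ∀ a : A,
      (TensorProduct.rid ℂ A)
        ((TensorProduct.map LinearMap.id (Coalgebra.counit (R := ℂ) (A := H))) (δ a)) = a)
    -- `δ(A_{(r,l)}) ⊆ ⊕_s A_{(r,s)} ⊗ H_{(s,l)}`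
    (hδgrad : ∀ (r l : Fin n → ℤ), ∀ a ∈ 𝒜 (r, l),
      δ a ∈ ⨆ s : Fin n → ℤ,
        LinearMap.range (TensorProduct.map (𝒜 (r, s)).subtype (ℋ (s, l)).subtype))
    -- both canonical maps descend to the balanced tensor products
    (hker : galRelOf δ (LinearMap.mul ℂ A) ≤ LinearMap.ker (chiOf δ (LinearMap.mul ℂ A)))
    (hkerΘ : galRelOf δ (defMul 𝒜 (phaseTheta θ)) ≤
      LinearMap.ker (chiOf δ (defMul 𝒜 (phaseTheta θ)))) :
    -- `χ_Θ` is bijective iff `χ` is bijective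
    (Function.Bijective
        ((galRelOf δ (defMul 𝒜 (phaseTheta θ))).liftQ
          (chiOf δ (defMul 𝒜 (phaseTheta θ))) hkerΘ) ↔
      Function.Bijective
        ((galRelOf δ (LinearMap.mul ℂ A)).liftQ (chiOf δ (LinearMap.mul ℂ A)) hker)) ∧
    -- when Hopf--Galois, the two translation maps have common representatives
    (Function.Bijective
        ((galRelOf δ (LinearMap.mul ℂ A)).liftQ (chiOf δ (LinearMap.mul ℂ A)) hker) →
      ∀ h : H, ∃ t : A ⊗[ℂ] A,
        chiOf δ (LinearMap.mul ℂ A) t = (1 : A) ⊗ₜ[ℂ] h ∧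
        chiOf δ (defMul 𝒜 (phaseTheta θ)) t = (1 : A) ⊗ₜ[ℂ] h) := by
  obtain ⟨Φ, hΦ⟩ : ∃ Φ : A ⊗[ℂ] A ≃ₗ[ℂ] A ⊗[ℂ] A,
      ∀ x, Φ x = gradedTwist 𝒜 𝒜 (leftPhase θ) x :=
    ⟨_, gradedTwistEquiv_apply 𝒜 𝒜 _ fun i j => phase_ne_zero θ i.1 j.1⟩
  obtain ⟨Ψ, hΨ⟩ : ∃ Ψ : A ⊗[ℂ] H ≃ₗ[ℂ] A ⊗[ℂ] H,
      ∀ x, Ψ x = gradedTwist 𝒜 ℋ (innerPhase θ) x :=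
    ⟨_, gradedTwistEquiv_apply 𝒜 ℋ _ fun i j => phase_ne_zero (-θ) i.2 j.1⟩
  have hχ (x) : chiOf δ (defMul 𝒜 (phaseTheta θ)) x =
      Ψ (chiOf δ (LinearMap.mul ℂ A) (Φ x)) := by
    rw [hΨ, hΦ, chiOf_phaseTheta hθ hδgrad]
  have hrel (x) : x ∈ galRelOf δ (defMul 𝒜 (phaseTheta θ)) ↔
      Φ x ∈ galRelOf δ (LinearMap.mul ℂ A) := by
    rw [hΦ, mem_galRelOf_phaseTheta_iff hcounit hδgrad]
  rw [Submodule.bijective_liftQ_iff, Submodule.bijective_liftQ_iff]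
  refine ⟨and_congr ?_ ?_, fun ⟨_, hsurj⟩ h => ?_⟩
  · simp only [hχ, hrel, LinearEquiv.map_eq_zero_iff]
    exact (Φ.surjective.forall (p := fun y =>
      chiOf δ (LinearMap.mul ℂ A) y = 0 → y ∈ galRelOf δ (LinearMap.mul ℂ A))).symm
  · have : ⇑(chiOf δ (defMul 𝒜 (phaseTheta θ))) = Ψ ∘ chiOf δ (LinearMap.mul ℂ A) ∘ Φ :=
      funext hχ
    rw [this, EquivLike.comp_surjective, EquivLike.surjective_comp]
  · obtain ⟨t, ht⟩ := hsurj (1 ⊗ₜ h)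
    exact exists_common_translation hθ hδgrad ht

end
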